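/- For n ≥ 1, the polynomial det Γ_n ∈ ℂ[δ] has degree Σ_{l=1}^{n} l·S(n,l), and the multiplicity of the irreducible factor δ in det Γ_n equals the Bell number B(n). -/

import Mathlib

/- Set partitions of a finite set are modelled as equivalence relations (`Setoid`);
   `nBlocks` is the number of blocks (equivalence classes), `p ⊔ q` is the join.
   `S n l` is the Stirling number of the second kind, `B n` the Bell number, and
   `Gram n` is the Gram matrix of the spine standard module of the partition algebra,
   over `ℂ[δ]` (with `δ = Polynomial.X`). -/

open scoped Classical

noncomputable section

def nBlocks {X : Type*} (s : Setoid X) : ℕ := Nat.card (Quotient s)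

def S (n l : ℕ) : ℕ := Nat.card {s : Setoid (Fin n) // nBlocks s = l}

def B (n : ℕ) : ℕ := ∑ l ∈ Finset.Icc 1 n, S n l

instance {X : Type*} [Finite X] : Finite (Setoid X) :=
  Finite.of_injective (fun s : Setoid X => (s.r : X → X → Prop)) fun s t h => by
    cases s; cases t; cases h; rfl

noncomputable instance (n : ℕ) : Fintype (Setoid (Fin n)) :=
  Fintype.ofFinite _

def Gram (n : ℕ) : Matrix (Setoid (Fin n)) (Setoid (Fin n)) (Polynomial ℂ) :=
  Matrix.of fun p q => (Polynomial.X : Polynomial ℂ) ^ nBlocks (p ⊔ q)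

/-- Partitioning the maps constant on the classes of `s` by their kernels. -/
theorem card_pow_nBlocks_eq_sum_descFactorial {X : Type*} [Finite X] [Fintype (Setoid X)]
    (s : Setoid X) (m : ℕ) :
    m ^ nBlocks s = ∑ r : Setoid X, if s ≤ r then m.descFactorial (nBlocks r) else 0 := by
  have hfun : Nat.card {f : X → Fin m // s ≤ Setoid.ker f} = m ^ nBlocks s := by
    rw [Nat.card_congr (Setoid.liftEquiv s), Nat.card_fun, Nat.card_fin, nBlocks]
  have hker (r : Setoid X) :
      Nat.card {f : X → Fin m // Setoid.ker f = r} = m.descFactorial (nBlocks r) := by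
    let e : {f : X → Fin m // Setoid.ker f = r} ≃ (Quotient r ↪ Fin m) :=
      { toFun := fun f => ⟨Quotient.lift f.1 fun a b h => by
            obtain ⟨f, rfl⟩ := f
            exact h, by
          obtain ⟨f, rfl⟩ := f
          rintro ⟨a⟩ ⟨b⟩ h
          exact Quotient.sound h⟩
        invFun := fun g => ⟨fun a => g ⟦a⟧, by
          ext a b
          simp [Setoid.ker_def, Quotient.eq]⟩
        left_inv := fun f => rfl
        right_inv := fun g => by
          ext a
          induction a using Quotient.inductionOn
          rfl }
    have := Fintype.ofFinite (Quotient r)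
    rw [Nat.card_congr e, Nat.card_eq_fintype_card, Fintype.card_embedding_eq, Fintype.card_fin,
      nBlocks, Nat.card_eq_fintype_card]
  have := Fintype.ofFinite X
  rw [← hfun, Nat.card_eq_fintype_card, Fintype.card_subtype,
    Finset.card_eq_sum_card_fiberwise (f := Setoid.ker) (t := Finset.univ) (by simp)]
  refine Finset.sum_congr rfl fun r _ => ?_
  split_ifs with h
  · rw [← hker, Nat.card_eq_fintype_card, Fintype.card_subtype, Finset.filter_filter]
    congr 1
    ext f
    simp only [Finset.mem_filter, Finset.mem_univ, true_and]
    exact ⟨fun hf => hf.2, fun hf => ⟨hf ▸ h, hf⟩⟩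
  · rw [Finset.card_eq_zero, Finset.filter_filter, Finset.filter_eq_empty_iff]
    rintro f - ⟨h₁, rfl⟩
    exact h h₁

theorem X_pow_nBlocks_eq_sum_descPochhammer {X : Type*} [Finite X] [Fintype (Setoid X)]
    (s : Setoid X) :
    (Polynomial.X : Polynomial ℂ) ^ nBlocks s =
      ∑ r : Setoid X, if s ≤ r then descPochhammer ℂ (nBlocks r) else 0 := by
  refine Polynomial.eq_of_infinite_eval_eq _ _
    ((Set.infinite_range_of_injective (Nat.cast_injective (R := ℂ))).mono ?_)
  rintro _ ⟨m, rfl⟩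
  simp only [Set.mem_ofPred_eq, Polynomial.eval_pow, Polynomial.eval_X, Polynomial.eval_finsetSum,
    apply_ite (Polynomial.eval (m : ℂ)), descPochhammer_eval_eq_descFactorial,
    Polynomial.eval_zero]
  exact_mod_cast card_pow_nBlocks_eq_sum_descFactorial s m

/-- The zeta matrix of a finite poset is unitriangular. -/
theorem det_zeta_matrix {α R : Type*} [Fintype α] [PartialOrder α] [CommRing R] :
    (Matrix.of fun p q : α => if p ≤ q then (1 : R) else 0).det = 1 := by
  let e : α ≃ LinearExtension α := Equiv.refl α
  have : Fintype (LinearExtension α) := Fintype.ofEquiv α e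
  rw [← Matrix.det_reindex_self e, Matrix.det_of_isUpperTriangular]
  · simp
  · intro i j hij
    have : ¬ e.symm i ≤ e.symm j := fun h => (toLinearExtension.monotone h).not_gt hij
    simp [this]

theorem det_Gram (n : ℕ) :
    (Gram n).det = ∏ p : Setoid (Fin n), descPochhammer ℂ (nBlocks p) := by
  set Z : Matrix (Setoid (Fin n)) (Setoid (Fin n)) (Polynomial ℂ) :=
    Matrix.of fun p q => if p ≤ q then 1 else 0 with hZ
  have h : Gram n = Z * Matrix.diagonal (fun p => descPochhammer ℂ (nBlocks p)) * Z.transpose := by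
    ext1 p q
    rw [Matrix.mul_apply]
    simp only [Gram, hZ, Matrix.of_apply, Matrix.mul_diagonal,
      Matrix.transpose_apply, X_pow_nBlocks_eq_sum_descPochhammer, sup_le_iff]
    refine Finset.sum_congr rfl fun r _ => ?_
    by_cases hp : p ≤ r <;> by_cases hq : q ≤ r <;> simp [hp, hq]
  rw [h, Matrix.det_mul, Matrix.det_mul, Matrix.det_transpose, Matrix.det_diagonal, hZ,
    det_zeta_matrix, one_mul, mul_one]

theorem rootMultiplicity_zero_descPochhammer_succ (k : ℕ) :
    (descPochhammer ℂ (k + 1)).rootMultiplicity 0 = 1 := by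
  induction k with
  | zero =>
    simpa using Polynomial.rootMultiplicity_X_sub_C_self (x := (0 : ℂ))
  | succ k ih =>
    rw [descPochhammer_succ_right, Polynomial.rootMultiplicity_mul, ih,
      Polynomial.rootMultiplicity_eq_zero]
    · simp [Polynomial.IsRoot, -Nat.cast_add]
    · rw [← descPochhammer_succ_right]
      exact (monic_descPochhammer ℂ _).ne_zero

theorem rootMultiplicity_prod {ι R : Type*} [CommRing R] [IsDomain R] (t : Finset ι)
    (f : ι → Polynomial R) (a : R) (hf : ∀ i ∈ t, f i ≠ 0) :
    (∏ i ∈ t, f i).rootMultiplicity a = ∑ i ∈ t, (f i).rootMultiplicity a := by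
  rw [← Polynomial.count_roots, Polynomial.roots_prod _ _ (Finset.prod_ne_zero_iff.2 hf),
    Multiset.count_bind]
  simp

theorem nBlocks_mem_Icc {n : ℕ} (hn : 1 ≤ n) (p : Setoid (Fin n)) :
    nBlocks p ∈ Finset.Icc 1 n := by
  have : Nonempty (Quotient p) := ⟨⟦⟨0, hn⟩⟧⟩
  refine Finset.mem_Icc.2 ⟨Nat.card_pos, ?_⟩
  simpa [nBlocks] using Nat.card_le_card_of_surjective _ (Quotient.mk_surjective (s := p))

theorem sum_comp_nBlocks {n : ℕ} (hn : 1 ≤ n) (g : ℕ → ℕ) :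
    ∑ p : Setoid (Fin n), g (nBlocks p) = ∑ l ∈ Finset.Icc 1 n, g l * S n l := by
  rw [← Finset.sum_fiberwise_of_maps_to (fun p _ => nBlocks_mem_Icc hn p)]
  refine Finset.sum_congr rfl fun l _ => ?_
  rw [Finset.sum_congr rfl fun p hp => by rw [(Finset.mem_filter.1 hp).2], Finset.sum_const,
    smul_eq_mul, mul_comm, S, Nat.card_eq_fintype_card, Fintype.card_subtype]

theorem gram_det_degree_and_rootMultiplicity (n : ℕ) (hn : 1 ≤ n) :
    (Gram n).det.degree = ((∑ l ∈ Finset.Icc 1 n, l * S n l : ℕ) : WithBot ℕ) ∧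
      (Gram n).det.rootMultiplicity 0 = B n := by
  rw [det_Gram]
  constructor
  · have hm : ∀ p ∈ (Finset.univ : Finset (Setoid (Fin n))),
        (descPochhammer ℂ (nBlocks p)).Monic := fun p _ => monic_descPochhammer ℂ _
    rw [Polynomial.degree_eq_natDegree (Polynomial.monic_prod_of_monic _ _ hm).ne_zero,
      Polynomial.natDegree_prod_of_monic _ _ hm]
    simp only [descPochhammer_natDegree]
    exact congrArg _ (sum_comp_nBlocks hn id)
  · rw [rootMultiplicity_prod _ _ _ fun p _ => (monic_descPochhammer ℂ _).ne_zero]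
    have h1 (p : Setoid (Fin n)) :
        (descPochhammer ℂ (nBlocks p)).rootMultiplicity 0 = 1 := by
      obtain ⟨k, hk⟩ := Nat.exists_eq_add_of_le' (Finset.mem_Icc.1 (nBlocks_mem_Icc hn p)).1
      rw [hk, rootMultiplicity_zero_descPochhammer_succ]
    simp only [h1, B, sum_comp_nBlocks hn fun _ => 1, one_mul]

end
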